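/- arXiv:1107.1885 — 4 statements merged into one kernel-verified Lean document; each statement's English description precedes it below -/
import Mathlib

section
/- Let w be a weight on ℝ with finite A_∞ constant [w]_{A_∞}, and suppose log w is locally integrable. Then for every bounded interval J of positive length, ⟨w·log w⟩_J ≤ ⟨w⟩_J · log(⟨w⟩_J) + e·[w]_{A_∞}·⟨w⟩_J. Consequently [w]_{RH_1} ≤ e·[w]_{A_∞}. -/
open MeasureTheory Real

/-- The average `⟨f⟩_{(a,b)} = (b-a)⁻¹ ∫_a^b f` of a function over a bounded interval. -/
noncomputable def intAvg (f : ℝ → ℝ) (a b : ℝ) : ℝ := (b - a)⁻¹ * ∫ t in a..b, f t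

/-- A bounded open subset of `ℝ` containing the point `x` has as its component at `x` an open
interval whose endpoints lie outside the set. -/
theorem exists_connectedComponentIn_eq_Ioo {E : Set ℝ} (hE : IsOpen E)
    (hbelow : BddBelow E) (habove : BddAbove E) {x : ℝ} (hx : x ∈ E) :
    ∃ c d : ℝ, c < d ∧ c ∉ E ∧ d ∉ E ∧ connectedComponentIn E x = Set.Ioo c d := by
  set K := connectedComponentIn E x with hK
  have hKo : IsOpen K := hE.connectedComponentIn
  have hxK : x ∈ K := mem_connectedComponentIn hx
  have hKE : K ⊆ E := connectedComponentIn_subset E x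
  have hKc : IsConnected K := isConnected_connectedComponentIn_iff.2 hx
  have hKb : BddBelow K := hbelow.mono hKE
  have hKa : BddAbove K := habove.mono hKE
  have hc : sInf K ∉ K := fun h => by
    obtain ⟨ε, hε, hsub⟩ := Metric.isOpen_iff.1 hKo _ h
    have := csInf_le hKb (hsub (show sInf K - ε / 2 ∈ _ by
      rw [Metric.mem_ball, Real.dist_eq, abs_lt]; constructor <;> linarith))
    linarith
  have hd : sSup K ∉ K := fun h => by
    obtain ⟨ε, hε, hsub⟩ := Metric.isOpen_iff.1 hKo _ h
    have := le_csSup hKa (hsub (show sSup K + ε / 2 ∈ _ by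
      rw [Metric.mem_ball, Real.dist_eq, abs_lt]; constructor <;> linarith))
    linarith
  have hlt : ∀ y ∈ K, sInf K < y := fun y hy =>
    lt_of_le_of_ne (csInf_le hKb hy) fun h => hc (h ▸ hy)
  have hgt : ∀ y ∈ K, y < sSup K := fun y hy =>
    lt_of_le_of_ne (le_csSup hKa hy) fun h => hd (h ▸ hy)
  have hKI : K = Set.Ioo (sInf K) (sSup K) :=
    Set.Subset.antisymm (fun y hy => ⟨hlt y hy, hgt y hy⟩) (hKc.Ioo_csInf_csSup_subset hKb hKa)
  have hcd : sInf K < sSup K := (hlt x hxK).trans (hgt x hxK)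
  refine ⟨sInf K, sSup K, hcd, fun h => hc ?_, fun h => hd ?_, hKI⟩
  · refine (isPreconnected_Ico (a := sInf K) (b := sSup K)).subset_connectedComponentIn
      ⟨(hlt x hxK).le, hgt x hxK⟩ (fun y hy => ?_) ⟨le_rfl, hcd⟩
    rcases hy.1.eq_or_lt with rfl | h'
    · exact h
    · exact hKE (hKI ▸ ⟨h', hy.2⟩)
  · refine (isPreconnected_Ioc (a := sInf K) (b := sSup K)).subset_connectedComponentIn
      ⟨hlt x hxK, (hgt x hxK).le⟩ (fun y hy => ?_) ⟨hcd, le_rfl⟩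
    rcases hy.2.eq_or_lt with rfl | h'
    · exact h
    · exact hKE (hKI ▸ ⟨hy.1, h'⟩)

/-- If a function has nonnegative integral over each component of a bounded open set, then it has
nonnegative integral over the whole set. -/
theorem setIntegral_nonneg_of_forall_component {E : Set ℝ} (hE : IsOpen E)
    (hbelow : BddBelow E) (habove : BddAbove E) {f : ℝ → ℝ} (hf : IntegrableOn f E)
    (h : ∀ c d : ℝ, c < d → c ∉ E → d ∉ E → Set.Ioo c d ⊆ E → 0 ≤ ∫ t in c..d, f t) :
    0 ≤ ∫ t in E, f t := by
  set C : Set (Set ℝ) := connectedComponentIn E '' E with hC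
  have hUnion : E = ⋃ K : C, (K : Set ℝ) := by
    ext x
    simp only [Set.mem_iUnion, Subtype.exists, exists_prop]
    constructor
    · exact fun hx => ⟨_, ⟨x, hx, rfl⟩, mem_connectedComponentIn hx⟩
    · rintro ⟨_, ⟨y, -, rfl⟩, hx⟩
      exact connectedComponentIn_subset E y hx
  have hopen : ∀ K ∈ C, IsOpen K := by
    rintro _ ⟨x, -, rfl⟩
    exact hE.connectedComponentIn
  have hdisj : C.PairwiseDisjoint id := by
    rintro _ ⟨x, -, rfl⟩ _ ⟨y, -, rfl⟩ hne
    refine Set.disjoint_left.2 fun z hzx hzy => hne ?_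
    rw [connectedComponentIn_eq hzx, connectedComponentIn_eq hzy]
  have hcount : C.Countable := by
    refine hdisj.countable_of_isOpen hopen ?_
    rintro _ ⟨x, hx, rfl⟩
    exact ⟨x, mem_connectedComponentIn hx⟩
  have : Countable C := hcount.to_subtype
  rw [hUnion, integral_iUnion (fun K : C => (hopen K.1 K.2).measurableSet)
    (fun K L hKL => hdisj K.2 L.2 fun h => hKL (Subtype.ext h)) (hUnion ▸ hf)]
  refine tsum_nonneg ?_
  rintro ⟨_, x, hx, rfl⟩
  obtain ⟨c, d, hcd, hc, hd, hK⟩ := exists_connectedComponentIn_eq_Ioo hE hbelow habove hx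
  have := h c d hcd hc hd (hK ▸ connectedComponentIn_subset E x)
  rwa [intervalIntegral.integral_of_le hcd.le, integral_Ioc_eq_integral_Ioo, ← hK] at this

/-- The points of `(a, b)` from which one sees, to the right, a value of `F` exceeding `F x` or
`F a`. -/
def risingSunSet (F : ℝ → ℝ) (a b : ℝ) : Set ℝ :=
  {x | x ∈ Set.Ioo a b ∧ ∃ y ∈ Set.Ioc x b, min (F x) (F a) < F y}

theorem isOpen_risingSunSet {F : ℝ → ℝ} (hF : Continuous F) (a b : ℝ) :
    IsOpen (risingSunSet F a b) := by
  have : risingSunSet F a b =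
      ⋃ y ∈ Set.Iic b, Set.Ioo a b ∩ Set.Iio y ∩ {x | min (F x) (F a) < F y} := by
    ext x
    simp only [risingSunSet, Set.mem_ofPred_eq, Set.mem_iUnion, Set.mem_inter_iff, Set.mem_Ioc,
      Set.mem_Iio, Set.mem_Iic, exists_prop]
    constructor
    · rintro ⟨hx, y, hy, h⟩
      exact ⟨y, hy.2, ⟨hx, hy.1⟩, h⟩
    · rintro ⟨y, hy, ⟨hx, hxy⟩, h⟩
      exact ⟨hx, y, ⟨hxy, hy⟩, h⟩
  rw [this]
  exact isOpen_biUnion fun y _ => (isOpen_Ioo.inter isOpen_Iio).inter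
    (isOpen_lt (hF.min continuous_const) continuous_const)

theorem risingSunSet_subset_Ioo (F : ℝ → ℝ) (a b : ℝ) : risingSunSet F a b ⊆ Set.Ioo a b :=
  fun _ hx => hx.1

/-- A variant of the rising sun lemma: if `F b ≤ F a`, then `F` takes equal values at the two
endpoints of every component, including the one starting at `a`. -/
theorem eq_of_component_risingSunSet {F : ℝ → ℝ} (hF : Continuous F) {a b c d : ℝ}
    (hab : F b ≤ F a) (hcd : c < d) (hc : c ∉ risingSunSet F a b) (hd : d ∉ risingSunSet F a b)
    (hsub : Set.Ioo c d ⊆ risingSunSet F a b) : F c = F d := by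
  have hac : a ≤ c := by
    by_contra! h
    obtain ⟨x, hx⟩ := exists_between (lt_min h hcd)
    have := (hsub ⟨hx.1, hx.2.trans_le (min_le_right _ _)⟩).1.1
    exact absurd (hx.2.trans_le (min_le_left _ _)) this.not_gt
  have hdb : d ≤ b := by
    by_contra! h
    obtain ⟨x, hx⟩ := exists_between (max_lt h hcd)
    have := (hsub ⟨(le_max_right _ _).trans_lt hx.1, hx.2⟩).1.2
    exact absurd ((le_max_left _ _).trans_lt hx.1) this.not_gt
  have hvis : ∀ x, a < x → x < b → x ∉ risingSunSet F a b → ∀ y, x < y → y ≤ b →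
      F y ≤ F x ∧ F y ≤ F a := by
    intro x hax hxb hx y hxy hyb
    by_contra h
    refine hx ⟨⟨hax, hxb⟩, y, ⟨hxy, hyb⟩, ?_⟩
    rw [min_lt_iff]
    by_contra! h'
    exact h h'
  have hlim : ∀ x, a < x → x < b → x ∉ risingSunSet F a b → F x ≤ F a := by
    intro x hax hxb hx
    refine le_of_tendsto (hF.continuousWithinAt (s := Set.Ioi x) (x := x)) ?_
    filter_upwards [Ioc_mem_nhdsGT hxb] with y hy
    exact (hvis x hax hxb hx y hy.1 hy.2).2
  have hca : F c ≤ F a := by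
    rcases hac.eq_or_lt with rfl | h
    · exact le_rfl
    · exact hlim c h (hcd.trans_le hdb) hc
  have hdc : F d ≤ F c := by
    rcases hac.eq_or_lt with rfl | h
    · rcases hdb.eq_or_lt with rfl | h'
      · exact hab
      · exact hlim d hcd h' hd
    · exact (hvis c h (hcd.trans_le hdb) hc d hcd hdb).1
  refine le_antisymm ?_ hdc
  by_contra! hlt
  obtain ⟨v, hdv, hvc⟩ := exists_between hlt
  obtain ⟨x, ⟨hx, hvx⟩, hmax⟩ :=
    (isCompact_Icc.inter_right (isClosed_le continuous_const hF) :
      IsCompact (Set.Icc c d ∩ {x | v ≤ F x})).exists_isGreatest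
      ⟨c, ⟨le_rfl, hcd.le⟩, hvc.le⟩
  have hxd : x < d := lt_of_le_of_ne hx.2 fun h => by
    subst h; exact absurd hvx (not_le.2 hdv)
  have hcx : c < x := by
    refine lt_of_le_of_ne hx.1 fun h => ?_
    subst h
    obtain ⟨y, hy, hyv⟩ := intermediate_value_Icc' hcd.le hF.continuousOn
      (⟨hdv.le, hvc.le⟩ : v ∈ Set.Icc (F d) (F c))
    have : y ≤ c := hmax ⟨hy, hyv.ge⟩
    have : y = c := le_antisymm this hy.1
    subst this
    exact hvc.ne' hyv
  obtain ⟨-, y, hy, hFy⟩ := hsub ⟨hcx, hxd⟩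
  have hvy : v < F y := lt_of_le_of_lt (le_min hvx (hvc.le.trans hca)) hFy
  rcases le_or_gt y d with hyd | hyd
  · exact absurd (hmax ⟨⟨hcx.le.trans hy.1.le, hyd⟩, hvy.le⟩) (not_le.2 hy.1)
  · have := (hvis d (hac.trans_lt hcd) (hyd.trans_le hy.2) hd y hyd hy.2).1
    linarith

/-- The rising sun set of a primitive of `f` contains almost every point at which `f` is
positive. -/
theorem ae_mem_risingSunSet_primitive {f : ℝ → ℝ} (hf : LocallyIntegrable f) (a b : ℝ) :
    ∀ᵐ x, x ∈ Set.Ioo a b → 0 < f x →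
      x ∈ risingSunSet (fun x => ∫ t in a..x, f t) a b := by
  filter_upwards [LocallyIntegrable.ae_hasDerivAt_integral hf] with x hx hxab hfx
  have hev := (hasDerivAt_iff_tendsto_slope.1 (hx a)).eventually (lt_mem_nhds hfx)
  have hev' : ∀ᶠ y in nhdsWithin x (Set.Ioi x), 0 < slope (fun x => ∫ t in a..x, f t) x y :=
    hev.filter_mono (nhdsWithin_mono _ fun y hy => ne_of_gt hy)
  obtain ⟨y, hy, hyb⟩ := (hev'.and (Ioc_mem_nhdsGT hxab.2)).exists
  refine ⟨hxab, y, hyb, min_lt_of_left_lt ?_⟩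
  exact (slope_pos_iff_of_le hyb.1.le).1 hy

theorem intervalIntegrable_of_locallyIntegrable {f : ℝ → ℝ} (hf : LocallyIntegrable f)
    {a b : ℝ} : IntervalIntegrable f volume a b :=
  (hf.integrableOn_isCompact isCompact_uIcc).intervalIntegrable

theorem ofReal_integral_le_lintegral_ofReal {α : Type*} {mα : MeasurableSpace α} {μ : Measure α}
    {f : α → ℝ} (hf : Integrable f μ) :
    ENNReal.ofReal (∫ x, f x ∂μ) ≤ ∫⁻ x, ENNReal.ofReal (f x) ∂μ := by
  rw [integral_eq_lintegral_pos_part_sub_lintegral_neg_part hf]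
  exact (ENNReal.ofReal_le_ofReal (sub_le_self _ ENNReal.toReal_nonneg)).trans
    ENNReal.ofReal_toReal_le

/-- Jensen's inequality, reversed by the `A_∞` bound `A`, on an interval where `w` has
average `l`. -/
theorem integral_log_sub_nonneg_of_integral_eq {w : ℝ → ℝ} (hw : LocallyIntegrable w)
    (hlog : LocallyIntegrable (fun t => log (w t))) {A l c d : ℝ} (hl : 0 < l) (hcd : c < d)
    (hA : intAvg w c d * exp (-(intAvg (fun t => log (w t)) c d)) ≤ A)
    (h : ∫ t in c..d, (w t - l) = 0) :
    0 ≤ ∫ t in c..d, (1 + log A - log l + log (w t) - w t / l) := by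
  have hwi : IntervalIntegrable w volume c d := intervalIntegrable_of_locallyIntegrable hw
  have hgi : IntervalIntegrable (fun t => log (w t)) volume c d :=
    intervalIntegrable_of_locallyIntegrable hlog
  have hdc : 0 < d - c := sub_pos.2 hcd
  have hint : ∫ t in c..d, w t = (d - c) * l := by
    rw [intervalIntegral.integral_sub hwi intervalIntegrable_const,
      intervalIntegral.integral_const, smul_eq_mul] at h
    linarith
  rw [intervalIntegral.integral_sub (intervalIntegrable_const.add hgi) (hwi.div_const l),
    intervalIntegral.integral_add intervalIntegrable_const hgi,
    intervalIntegral.integral_const, smul_eq_mul, intervalIntegral.integral_div, hint]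
  have havg : intAvg w c d = l := by
    rw [intAvg, hint]; field_simp
  rw [havg] at hA
  have hlogA := log_le_log (by positivity) hA
  rw [log_mul hl.ne' (exp_pos _).ne', log_exp, intAvg] at hlogA
  set G := ∫ t in c..d, log (w t)
  have hG : (d - c)⁻¹ * G * (d - c) = G := by field_simp
  have : (d - c) * l / l = d - c := by field_simp
  rw [this]
  nlinarith

/-- The distributional inequality behind the comparison of `RH₁` and `A_∞`. -/
theorem lintegral_superlevel_le_lintegral_log {w : ℝ → ℝ} (hw : LocallyIntegrable w)
    (hpos : ∀ᵐ t ∂volume, 0 < w t) (hlog : LocallyIntegrable (fun t => log (w t))) {A : ℝ}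
    (hA : ∀ a b : ℝ, a < b → intAvg w a b * exp (-(intAvg (fun t => log (w t)) a b)) ≤ A)
    {a b l : ℝ} (hab : a < b) (hl : 0 < l) (hle : intAvg w a b ≤ l) :
    ∫⁻ x in Set.Ioo a b, ENNReal.ofReal (if l < w x then w x / l else 0) ≤
      ∫⁻ x in Set.Ioo a b, ENNReal.ofReal (1 + log A - log l + log (w x)) := by
  have hf : LocallyIntegrable (fun t => w t - l) := hw.sub (locallyIntegrable_const l)
  set F : ℝ → ℝ := fun x => ∫ t in a..x, (w t - l) with hFdef
  have hF : Continuous F :=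
    intervalIntegral.continuous_primitive (fun _ _ => intervalIntegrable_of_locallyIntegrable hf) a
  set E := risingSunSet F a b with hE
  have hEo : IsOpen E := isOpen_risingSunSet hF a b
  have hEsub : E ⊆ Set.Ioo a b := risingSunSet_subset_Ioo F a b
  have hFab : F b ≤ F a := by
    simp only [hFdef, intervalIntegral.integral_same]
    rw [intervalIntegral.integral_sub (intervalIntegrable_of_locallyIntegrable hw)
      intervalIntegrable_const, intervalIntegral.integral_const, smul_eq_mul]
    rw [intAvg, inv_mul_le_iff₀ (sub_pos.2 hab)] at hle
    linarith
  have hEI : E ⊆ Set.Icc a b := hEsub.trans Set.Ioo_subset_Icc_self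
  have hwE : IntegrableOn w E := (hw.integrableOn_isCompact isCompact_Icc).mono_set hEI
  have hgE : IntegrableOn (fun t => 1 + log A - log l + log (w t)) E :=
    (((locallyIntegrable_const _).add hlog).integrableOn_isCompact isCompact_Icc).mono_set hEI
  have key : 0 ≤ ∫ t in E, (1 + log A - log l + log (w t) - w t / l) := by
    refine setIntegral_nonneg_of_forall_component hEo (bddBelow_Ioo.mono hEsub)
      (bddAbove_Ioo.mono hEsub) (hgE.sub (hwE.div_const l)) fun c d hcd hc hd hsub => ?_
    refine integral_log_sub_nonneg_of_integral_eq hw hlog hl hcd (hA c d hcd) ?_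
    have := eq_of_component_risingSunSet hF hFab hcd hc hd hsub
    rw [← intervalIntegral.integral_interval_sub_left (a := a)
      (intervalIntegrable_of_locallyIntegrable hf) (intervalIntegrable_of_locallyIntegrable hf)]
    exact sub_eq_zero.2 this.symm
  rw [integral_sub hgE (hwE.div_const l), sub_nonneg] at key
  calc ∫⁻ x in Set.Ioo a b, ENNReal.ofReal (if l < w x then w x / l else 0)
      ≤ ∫⁻ x in Set.Ioo a b, E.indicator (fun x => ENNReal.ofReal (w x / l)) x := by
        refine lintegral_mono_ae ?_
        filter_upwards [ae_restrict_mem measurableSet_Ioo,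
          ae_restrict_of_ae (ae_mem_risingSunSet_primitive hf a b)] with x hx hxE
        split_ifs with hlt
        · rw [Set.indicator_of_mem (hxE hx (sub_pos.2 hlt))]
        · simp
    _ ≤ ∫⁻ x in E, ENNReal.ofReal (w x / l) := by
        rw [← lintegral_indicator hEo.measurableSet]
        exact setLIntegral_le_lintegral _ _
    _ = ENNReal.ofReal (∫ x in E, w x / l) := by
        refine (ofReal_integral_eq_lintegral_ofReal (hwE.div_const l) ?_).symm
        filter_upwards [ae_restrict_of_ae hpos] with x hx
        exact (div_pos hx hl).le
    _ ≤ ENNReal.ofReal (∫ x in E, (1 + log A - log l + log (w x))) :=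
        ENNReal.ofReal_le_ofReal key
    _ ≤ ∫⁻ x in E, ENNReal.ofReal (1 + log A - log l + log (w x)) :=
        ofReal_integral_le_lintegral_ofReal hgE
    _ ≤ _ := lintegral_mono_set hEsub

theorem lintegral_Ioi_ofReal_log_sub_log_le {c m : ℝ} (hc : 0 < c) (hm : 0 ≤ m) :
    ∫⁻ l in Set.Ioi m, ENNReal.ofReal (log c - log l) ≤ ENNReal.ofReal c := by
  have hint : IntegrableOn (fun l => log c - log l) (Set.Ioc 0 c) := by
    rw [← intervalIntegrable_iff_integrableOn_Ioc_of_le hc.le]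
    exact intervalIntegrable_const.sub intervalIntegral.intervalIntegrable_log'
  calc ∫⁻ l in Set.Ioi m, ENNReal.ofReal (log c - log l)
      ≤ ∫⁻ l in Set.Ioi m, (Set.Ioc 0 c).indicator
          (fun l => ENNReal.ofReal (log c - log l)) l := by
        refine setLIntegral_mono' measurableSet_Ioi fun l hl => ?_
        have hl0 : 0 < l := hm.trans_lt hl
        rcases le_or_gt l c with h | h
        · rw [Set.indicator_of_mem (show l ∈ Set.Ioc 0 c from ⟨hl0, h⟩)]
        · rw [ENNReal.ofReal_of_nonpos (sub_nonpos.2 (log_le_log hc h.le))]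
          exact zero_le
    _ ≤ ∫⁻ l in Set.Ioc 0 c, ENNReal.ofReal (log c - log l) := by
        rw [← lintegral_indicator measurableSet_Ioc]
        exact setLIntegral_le_lintegral _ _
    _ = ENNReal.ofReal (∫ l in Set.Ioc 0 c, (log c - log l)) := by
        refine (ofReal_integral_eq_lintegral_ofReal hint ?_).symm
        filter_upwards [ae_restrict_mem measurableSet_Ioc] with l hl
        exact sub_nonneg.2 (log_le_log hl.1 hl.2)
    _ = ENNReal.ofReal c := by
        rw [← intervalIntegral.integral_of_le hc.le,
          intervalIntegral.integral_sub intervalIntegrable_const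
            intervalIntegral.intervalIntegrable_log', integral_log,
          intervalIntegral.integral_const, smul_eq_mul]
        congr 1
        ring

theorem ofReal_mul_log_sub_log_le_lintegral_Ioi {u m : ℝ} (hu : 0 < u) (hm : 0 < m) :
    ENNReal.ofReal (u * (log u - log m)) ≤
      ∫⁻ l in Set.Ioi m, ENNReal.ofReal (if l < u then u / l else 0) := by
  rcases le_or_gt u m with h | h
  · rw [ENNReal.ofReal_of_nonpos]
    · exact zero_le
    · exact mul_nonpos_of_nonneg_of_nonpos hu.le (sub_nonpos.2 (log_le_log hu h))
  have hnot : (0 : ℝ) ∉ Set.uIcc m u := by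
    rw [Set.uIcc_of_le h.le]
    exact fun h0 => hm.not_ge h0.1
  have hint : IntegrableOn (fun l => u * (1 / l)) (Set.Ioo m u) := by
    rw [← integrableOn_Ioc_iff_integrableOn_Ioo,
      ← intervalIntegrable_iff_integrableOn_Ioc_of_le h.le]
    exact (intervalIntegral.intervalIntegrable_one_div (fun x hx h0 => hnot (h0 ▸ hx))
      continuousOn_id).const_mul u
  calc ENNReal.ofReal (u * (log u - log m))
      = ENNReal.ofReal (∫ l in Set.Ioo m u, u * (1 / l)) := by
        rw [← integral_Ioc_eq_integral_Ioo, ← intervalIntegral.integral_of_le h.le,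
          intervalIntegral.integral_const_mul, integral_one_div_of_pos hm hu,
          log_div hu.ne' hm.ne']
    _ ≤ ∫⁻ l in Set.Ioo m u, ENNReal.ofReal (u * (1 / l)) :=
        ofReal_integral_le_lintegral_ofReal hint
    _ = ∫⁻ l in Set.Ioo m u, ENNReal.ofReal (if l < u then u / l else 0) := by
        refine setLIntegral_congr_fun measurableSet_Ioo fun l hl => ?_
        simp only [if_pos hl.2, mul_one_div]
    _ ≤ _ := lintegral_mono_set Set.Ioo_subset_Ioi_self

theorem lintegral_mul_log_sub_log_le {w : ℝ → ℝ} (hw : LocallyIntegrable w)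
    (hpos : ∀ᵐ t ∂volume, 0 < w t) (hlog : LocallyIntegrable (fun t => log (w t))) {A : ℝ}
    (hA0 : 0 < A)
    (hA : ∀ a b : ℝ, a < b → intAvg w a b * exp (-(intAvg (fun t => log (w t)) a b)) ≤ A)
    {a b : ℝ} (hab : a < b) (hm : 0 < intAvg w a b) :
    ∫⁻ x in Set.Ioo a b, ENNReal.ofReal (w x * (log (w x) - log (intAvg w a b))) ≤
      ENNReal.ofReal (exp 1 * A * ∫ x in Set.Ioo a b, w x) := by
  set m := intAvg w a b
  have hwI : IntegrableOn w (Set.Ioo a b) :=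
    (hw.integrableOn_isCompact isCompact_Icc).mono_set Set.Ioo_subset_Icc_self
  have hposI : ∀ᵐ x ∂volume.restrict (Set.Ioo a b), 0 < w x := ae_restrict_of_ae hpos
  have hpair : AEMeasurable (fun p : ℝ × ℝ => (p.1, w p.2))
      ((volume.restrict (Set.Ioi m)).prod (volume.restrict (Set.Ioo a b))) :=
    measurable_fst.aemeasurable.prodMk
      (hwI.aestronglyMeasurable.aemeasurable.comp_quasiMeasurePreserving
        Measure.quasiMeasurePreserving_snd)
  have hm1 : Measurable fun p : ℝ × ℝ =>
      ENNReal.ofReal (if p.1 < p.2 then p.2 / p.1 else 0) :=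
    (Measurable.ite (measurableSet_lt measurable_fst measurable_snd)
      (measurable_snd.div measurable_fst) measurable_const).ennreal_ofReal
  have hm2 : Measurable fun p : ℝ × ℝ =>
      ENNReal.ofReal (1 + log A - log p.1 + log p.2) := by fun_prop
  calc ∫⁻ x in Set.Ioo a b, ENNReal.ofReal (w x * (log (w x) - log m))
      ≤ ∫⁻ x in Set.Ioo a b, ∫⁻ l in Set.Ioi m,
          ENNReal.ofReal (if l < w x then w x / l else 0) := by
        refine lintegral_mono_ae ?_
        filter_upwards [hposI] with x hx
        exact ofReal_mul_log_sub_log_le_lintegral_Ioi hx hm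
    _ = ∫⁻ l in Set.Ioi m, ∫⁻ x in Set.Ioo a b,
          ENNReal.ofReal (if l < w x then w x / l else 0) :=
        (lintegral_lintegral_swap (f := fun l x => ENNReal.ofReal (if l < w x then w x / l else 0))
          (hm1.comp_aemeasurable hpair)).symm
    _ ≤ ∫⁻ l in Set.Ioi m, ∫⁻ x in Set.Ioo a b,
          ENNReal.ofReal (1 + log A - log l + log (w x)) :=
        setLIntegral_mono' measurableSet_Ioi fun l hl =>
          lintegral_superlevel_le_lintegral_log hw hpos hlog hA hab (hm.trans hl) (le_of_lt hl)
    _ = ∫⁻ x in Set.Ioo a b, ∫⁻ l in Set.Ioi m,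
          ENNReal.ofReal (1 + log A - log l + log (w x)) :=
        lintegral_lintegral_swap (f := fun l x => ENNReal.ofReal (1 + log A - log l + log (w x)))
          (hm2.comp_aemeasurable hpair)
    _ ≤ ∫⁻ x in Set.Ioo a b, ENNReal.ofReal (exp 1 * A * w x) := by
        refine lintegral_mono_ae ?_
        filter_upwards [hposI] with x hx
        refine le_of_eq_of_le (lintegral_congr fun l => ?_)
          (lintegral_Ioi_ofReal_log_sub_log_le (c := exp 1 * A * w x) (by positivity) hm.le)
        rw [log_mul (by positivity) hx.ne', log_mul (exp_pos _).ne' hA0.ne', log_exp]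
        congr 1
        ring
    _ = _ := by
        rw [← integral_const_mul]
        refine (ofReal_integral_eq_lintegral_ofReal (hwI.const_mul _) ?_).symm
        filter_upwards [hposI] with x hx
        exact (by positivity)

theorem sub_le_mul_log_sub_log {u m : ℝ} (hu : 0 < u) (hm : 0 < m) :
    u - m ≤ u * (log u - log m) := by
  have h := log_le_sub_one_of_pos (div_pos hm hu)
  rw [log_div hm.ne' hu.ne'] at h
  have h' : u * (log m - log u) ≤ u * (m / u - 1) := mul_le_mul_of_nonneg_left h hu.le
  have : u * (m / u - 1) = m - u := by field_simp
  linarith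

/-- **Theorem (comparability of `RH₁` and `A_∞` constants, upper bound).**
If `w` is a weight on `ℝ` (locally integrable, a.e. positive) with `log w` locally
integrable and `A` is a bound for its `A_∞` constant, i.e.
`⟨w⟩_J · exp(−⟨log w⟩_J) ≤ A` for every bounded interval `J` of positive length, then
for every such interval `J`,
`⟨w log w⟩_J ≤ ⟨w⟩_J · log ⟨w⟩_J + e · A · ⟨w⟩_J`;
consequently `[w]_{RH₁} ≤ e · [w]_{A_∞}`. -/
theorem rh1_le_e_mul_ainfty
    (w : ℝ → ℝ) (hw : LocallyIntegrable w)
    (hpos : ∀ᵐ t ∂volume, 0 < w t)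
    (hlog : LocallyIntegrable (fun t => Real.log (w t)))
    (A : ℝ)
    (hA : ∀ a b : ℝ, a < b →
      intAvg w a b * Real.exp (-(intAvg (fun t => Real.log (w t)) a b)) ≤ A) :
    ∀ a b : ℝ, a < b →
      intAvg (fun t => w t * Real.log (w t)) a b ≤
        intAvg w a b * Real.log (intAvg w a b) + Real.exp 1 * A * intAvg w a b := by
  intro a b hab
  have hba : 0 < b - a := sub_pos.2 hab
  have hm : 0 < intAvg w a b := by
    refine mul_pos (inv_pos.2 hba) ((intervalIntegral.integral_pos_iff_support_of_nonneg_ae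
      (hpos.mono fun x hx => hx.le) (intervalIntegrable_of_locallyIntegrable hw)).2 ⟨hab, ?_⟩)
    refine lt_of_lt_of_le (b := volume (Set.Ioc a b)) (by simpa using hab) (measure_mono_ae ?_)
    filter_upwards [hpos] with x hx hxab
    exact ⟨hx.ne', hxab⟩
  have hA0 : 0 < A := (mul_pos hm (exp_pos _)).trans_le (hA a b hab)
  have hbound := lintegral_mul_log_sub_log_le hw hpos hlog hA0 hA hab hm
  have hIoo (f : ℝ → ℝ) : ∫ x in a..b, f x = ∫ x in Set.Ioo a b, f x := by
    rw [intervalIntegral.integral_of_le hab.le, integral_Ioc_eq_integral_Ioo]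
  have hwI : IntegrableOn w (Set.Ioo a b) :=
    (hw.integrableOn_isCompact isCompact_Icc).mono_set Set.Ioo_subset_Icc_self
  have hposI : ∀ᵐ x ∂volume.restrict (Set.Ioo a b), 0 < w x := ae_restrict_of_ae hpos
  have hW : 0 ≤ ∫ x in Set.Ioo a b, w x :=
    integral_nonneg_of_ae (hposI.mono fun x hx => hx.le)
  have hwm := hwI.aestronglyMeasurable.aemeasurable
  set m := intAvg w a b with hmdef
  have hk : IntegrableOn (fun x => w x * (log (w x) - log m)) (Set.Ioo a b) := by
    have hsub : IntegrableOn (fun x => w x - m) (Set.Ioo a b) :=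
      hwI.sub (integrableOn_const (by simp))
    have hdiff : IntegrableOn (fun x => w x * (log (w x) - log m) - (w x - m))
        (Set.Ioo a b) := by
      refine (lintegral_ofReal_ne_top_iff_integrable ?_ ?_).1 (ne_top_of_le_ne_top ?_
        (lintegral_mono_ae (g := fun x => ENNReal.ofReal (w x * (log (w x) - log m)) +
          ENNReal.ofReal m) ?_))
      · exact AEMeasurable.aestronglyMeasurable (by fun_prop)
      · filter_upwards [hposI] with x hx
        exact sub_nonneg.2 (sub_le_mul_log_sub_log hx hm)
      · rw [lintegral_add_right _ measurable_const]
        refine ENNReal.add_ne_top.2 ⟨ne_top_of_le_ne_top ENNReal.ofReal_ne_top hbound, ?_⟩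
        simp [ENNReal.mul_eq_top]
      · filter_upwards [hposI] with x hx
        refine (ENNReal.ofReal_le_ofReal ?_).trans ENNReal.ofReal_add_le
        linarith
    exact (hdiff.add hsub).congr (Filter.Eventually.of_forall fun x => sub_add_cancel _ _)
  have hkle : ∫ x in Set.Ioo a b, w x * (log (w x) - log m) ≤
      exp 1 * A * ∫ x in Set.Ioo a b, w x :=
    (ENNReal.ofReal_le_ofReal_iff (by positivity)).1
      ((ofReal_integral_le_lintegral_ofReal hk).trans hbound)
  have hsplit : ∫ x in Set.Ioo a b, w x * log (w x) =
      (∫ x in Set.Ioo a b, w x * (log (w x) - log m)) +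
        (∫ x in Set.Ioo a b, w x) * log m := by
    rw [← integral_mul_const, ← integral_add hk (hwI.mul_const _)]
    congr 1 with x
    ring
  have hmW : m = (b - a)⁻¹ * ∫ x in Set.Ioo a b, w x := by rw [hmdef, intAvg, hIoo]
  rw [intAvg, hIoo, hsplit]
  calc (b - a)⁻¹ * ((∫ x in Set.Ioo a b, w x * (log (w x) - log m)) +
        (∫ x in Set.Ioo a b, w x) * log m)
      ≤ (b - a)⁻¹ * (exp 1 * A * (∫ x in Set.Ioo a b, w x) +
        (∫ x in Set.Ioo a b, w x) * log m) := by gcongr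
    _ = ((b - a)⁻¹ * ∫ x in Set.Ioo a b, w x) * log m +
        exp 1 * A * ((b - a)⁻¹ * ∫ x in Set.Ioo a b, w x) := by ring
    _ = m * log m + exp 1 * A * m := by rw [← hmW]
end

section
/- For Q > 1 let γ(Q) be the unique root in (0,1) of the equation t − log t = 1 + log Q. Then lim_{Q→∞} (1/γ(Q) + log γ(Q) − 1)/Q = e. (This shows the constant e in the inequality [w]_{RH_1} ≤ e·[w]_{A_∞} is best possible.) -/
open Real Filter

/-- A root of `t - log t = 1 + log Q` satisfies `1 / t = Q * exp (1 - t)`. -/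
lemma one_div_eq_mul_exp_of_sub_log_eq {t Q : ℝ} (ht : 0 < t) (hQ : 0 < Q)
    (h : t - Real.log t = 1 + Real.log Q) : 1 / t = Q * Real.exp (1 - t) := by
  have hlog : -Real.log t = Real.log Q + (1 - t) := by linarith
  rw [one_div, ← Real.exp_log (inv_pos.2 ht), Real.log_inv, hlog, Real.exp_add, Real.exp_log hQ]

/-- **Sharpness of the constant `e`.**
For `Q > 1` let `γ Q` be the unique root in `(0,1)` of `t − log t = 1 + log Q`. Then
`(1/γ(Q) + log γ(Q) − 1)/Q → e` as `Q → ∞`; this shows the constant `e` in the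
inequality `[w]_{RH₁} ≤ e·[w]_{A_∞}` is best possible. -/
theorem limit_gamma_ratio_eq_e (γ : ℝ → ℝ)
    (hγ : ∀ Q : ℝ, 1 < Q →
      γ Q ∈ Set.Ioo (0:ℝ) 1 ∧ γ Q - Real.log (γ Q) = 1 + Real.log Q) :
    Filter.Tendsto (fun Q : ℝ => (1 / γ Q + Real.log (γ Q) - 1) / Q)
      Filter.atTop (nhds (Real.exp 1)) := by
  have hγ0 : Tendsto γ atTop (nhds 0) := by
    refine squeeze_zero' ?_ ?_ tendsto_inv_atTop_zero
    · filter_upwards [eventually_gt_atTop 1] with Q hQ using (hγ Q hQ).1.1.le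
    · filter_upwards [eventually_gt_atTop 1] with Q hQ
      obtain ⟨⟨h0, h1⟩, h⟩ := hγ Q hQ
      have hQ0 : 0 < Q := by linarith
      rw [← Real.log_le_log_iff h0 (inv_pos.2 hQ0), Real.log_inv]
      linarith
  have hlog : Tendsto (fun Q : ℝ => Real.log Q / Q) atTop (nhds 0) :=
    Real.isLittleO_log_id_atTop.tendsto_div_nhds_zero
  have hmain : Tendsto (fun Q => Real.exp (1 - γ Q) + ((γ Q - 2) * Q⁻¹ - Real.log Q / Q))
      atTop (nhds (Real.exp (1 - 0) + ((0 - 2) * 0 - 0))) :=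
    ((Real.continuous_exp.tendsto _).comp (hγ0.const_sub 1)).add
      (((hγ0.sub_const 2).mul tendsto_inv_atTop_zero).sub hlog)
  simp only [sub_zero, mul_zero, add_zero] at hmain
  refine hmain.congr' ?_
  filter_upwards [eventually_gt_atTop 1] with Q hQ
  obtain ⟨⟨h0, _⟩, h⟩ := hγ Q hQ
  have hQ0 : 0 < Q := by linarith
  rw [one_div_eq_mul_exp_of_sub_log_eq h0 hQ0 h,
    show Real.log (γ Q) = γ Q - 1 - Real.log Q by linarith]
  field_simp
  ring
end

section
/- Let Q > 0 and let γ_− ∈ (0,1) be the smaller root of the equation t − log t = Q + 1. Let w be a weight on ℝ such that w·log w and log w are locally integrable and [w]_{RH_1} ≤ Q. Then for every bounded interval J of positive length, ⟨w⟩_J · exp(−⟨log w⟩_J) ≤ γ_− · exp((1−γ_−)/γ_−); consequently [w]_{A_∞} ≤ γ_− · exp((1−γ_−)/γ_−). -/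
open MeasureTheory Real

theorem exists_disjoint_intervals_of_le {f : ℝ → ℝ} (hf : Continuous f) {a b : ℝ}
    (hmin : ∀ x ∈ Set.Icc a b, f a ≤ f x) :
    ∃ S : Set (ℝ × ℝ), S.Countable ∧ S.PairwiseDisjoint (fun p => Set.Ioo p.1 p.2) ∧
      (∀ p ∈ S, a ≤ p.1 ∧ p.1 < p.2 ∧ p.2 ≤ b ∧ f p.1 = f p.2) ∧
      ∀ x ∈ Set.Icc a b, (∀ p ∈ S, x ∉ Set.Icc p.1 p.2) → ∀ y ∈ Set.Icc x b, f x ≤ f y := by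
  have hex : ∀ x, ∃ y, x ≤ b → y ∈ Set.Icc x b ∧ ∀ z ∈ Set.Icc x b, f y ≤ f z := by
    intro x
    by_cases hx : x ≤ b
    · obtain ⟨y, hy, hy'⟩ := isCompact_Icc.exists_isMinOn (Set.nonempty_Icc.2 hx)
        hf.continuousOn
      exact ⟨y, fun _ => ⟨hy, fun z hz => hy' hz⟩⟩
    · exact ⟨x, fun h => absurd h hx⟩
  choose p hp using hex
  have hmono : ∀ x y, x ≤ y → y ≤ b → f (p x) ≤ f (p y) := fun x y hxy hyb =>
    (hp x (hxy.trans hyb)).2 _ ⟨hxy.trans (hp y hyb).1.1, (hp y hyb).1.2⟩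
  let F : ℝ → Set ℝ := fun t => {x | x ∈ Set.Icc a b ∧ f (p x) = t}
  have hFbb : ∀ t, BddBelow (F t) := fun t => ⟨a, fun x hx => hx.1.1⟩
  have hFba : ∀ t, BddAbove (F t) := fun t => ⟨b, fun x hx => hx.1.2⟩
  have hsub : ∀ t, Set.Ioo (sInf (F t)) (sSup (F t)) ⊆ F t := by
    intro t x hx
    have hne : (F t).Nonempty := by
      by_contra h
      rw [Set.not_nonempty_iff_eq_empty] at h
      simp [h] at hx
    obtain ⟨y, hy, hyx⟩ := exists_lt_of_csInf_lt hne hx.1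
    obtain ⟨z, hz, hxz⟩ := exists_lt_of_lt_csSup hne hx.2
    refine ⟨⟨hy.1.1.trans hyx.le, hxz.le.trans hz.1.2⟩, le_antisymm ?_ ?_⟩
    · exact (hmono x z hxz.le hz.1.2).trans hz.2.le
    · exact hy.2.symm.le.trans (hmono y x hyx.le (hxz.le.trans hz.1.2))
  have hpF : ∀ x ∈ Set.Icc a b, p x ∈ F (f (p x)) := by
    intro x hx
    have h := (hp x hx.2).1
    refine ⟨⟨hx.1.trans h.1, h.2⟩, le_antisymm ?_ (hmono _ _ h.1 h.2)⟩
    exact (hp (p x) h.2).2 _ ⟨le_rfl, h.2⟩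
  let T : Set ℝ := {t | (F t).Nontrivial}
  have hlt : ∀ t ∈ T, sInf (F t) < sSup (F t) := by
    rintro t ht
    obtain ⟨x, hx, y, hy, hxy⟩ := ht.exists_lt
    exact (csInf_le (hFbb t) hx).trans_lt (hxy.trans_le (le_csSup (hFba t) hy))
  have hdisj : T.PairwiseDisjoint (fun t => Set.Ioo (sInf (F t)) (sSup (F t))) := by
    intro s _ t _ hst
    refine Set.disjoint_left.2 fun x hx hx' => hst ?_
    rw [← (hsub s hx).2, ← (hsub t hx').2]
  have hTc : T.Countable := hdisj.countable_of_isOpen (fun _ _ => isOpen_Ioo)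
    (fun t ht => Set.nonempty_Ioo.2 (hlt t ht))
  have hbounds : ∀ t ∈ T, a ≤ sInf (F t) ∧ sSup (F t) ≤ b := fun t ht =>
    ⟨le_csInf ht.nonempty fun x hx => hx.1.1, csSup_le ht.nonempty fun x hx => hx.1.2⟩
  have hright : ∀ t ∈ T, f (sSup (F t)) = t := by
    intro t ht
    have hcl : IsClosed {y | f y = t} := isClosed_eq hf continuous_const
    have : sSup (F t) ∈ closure {y | f y = t} := by
      rw [Metric.mem_closure_iff]
      intro ε hε
      obtain ⟨x, hx, hx'⟩ := exists_lt_of_lt_csSup ht.nonempty (sub_lt_self (sSup (F t)) hε)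
      have h1 : p x ∈ F t := by have := hpF x hx.1; rwa [hx.2] at this
      refine ⟨p x, hx.2, ?_⟩
      have h2 := le_csSup (hFba t) h1
      have h3 := (hp x hx.1.2).1.1
      rw [Real.dist_eq, abs_of_nonneg] <;> linarith
    rwa [hcl.closure_eq] at this
  have hleft : ∀ t ∈ T, f (sInf (F t)) = t := by
    intro t ht
    apply le_antisymm
    · rcases (hbounds t ht).1.eq_or_lt with h | h
      · obtain ⟨x, hx⟩ := ht.nonempty
        rw [← h, ← hx.2]
        exact hmin _ (hpF x hx.1).1
      · have hcl : IsClosed {y | f y ≤ t} := isClosed_le hf continuous_const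
        have : sInf (F t) ∈ closure {y | f y ≤ t} := by
          rw [Metric.mem_closure_iff]
          intro ε hε
          obtain ⟨x, hx1, hx2⟩ := exists_between (max_lt h (sub_lt_self (sInf (F t)) hε))
          rw [max_lt_iff] at hx1
          obtain ⟨z, hz⟩ := ht.nonempty
          have hxz : x ≤ z := hx2.le.trans (csInf_le (hFbb t) hz)
          have hxb : x ≤ b := hxz.trans hz.1.2
          have hle : f (p x) ≤ t := (hmono x z hxz hz.1.2).trans hz.2.le
          have hxF : x ∉ F t := fun hx => absurd (csInf_le (hFbb t) hx) (not_le.2 hx2)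
          have hlt' : f (p x) < t :=
            lt_of_le_of_ne hle fun h => hxF ⟨⟨hx1.1.le, hxb⟩, h⟩
          have hpx : p x ≤ sInf (F t) := by
            by_contra! hc
            obtain ⟨y, hy, hy'⟩ := exists_lt_of_csInf_lt ht.nonempty hc
            have := (hp y hy.1.2).2 (p x) ⟨hy'.le, (hp x hxb).1.2⟩
            rw [hy.2] at this
            linarith
          refine ⟨p x, hle, ?_⟩
          have := (hp x hxb).1.1
          rw [Real.dist_eq, abs_of_nonneg] <;> linarith [hx1.2]
        rwa [hcl.closure_eq] at this
    · have hcl : IsClosed {y | t ≤ f y} := isClosed_le continuous_const hf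
      have : sInf (F t) ∈ closure {y | t ≤ f y} := by
        refine closure_mono ?_ (csInf_mem_closure ht.nonempty (hFbb t))
        intro x hx
        exact hx.2.symm.le.trans ((hp x hx.1.2).2 x ⟨le_rfl, hx.1.2⟩)
      rwa [hcl.closure_eq] at this
  refine ⟨(fun t => (sInf (F t), sSup (F t))) '' T, hTc.image _, ?_, ?_, ?_⟩
  · rintro _ ⟨s, hs, rfl⟩ _ ⟨t, ht, rfl⟩ hst
    exact hdisj hs ht fun h => hst (by rw [h])
  · rintro _ ⟨t, ht, rfl⟩
    exact ⟨(hbounds t ht).1, hlt t ht, (hbounds t ht).2, (hleft t ht).trans (hright t ht).symm⟩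
  · intro x hx hxS y hy
    have hxF : x ∈ F (f (p x)) := ⟨hx, rfl⟩
    have hpx : p x = x := by
      by_contra hne
      exact hxS _ ⟨f (p x), ⟨p x, hpF x hx, x, hxF, hne⟩, rfl⟩
        ⟨csInf_le (hFbb _) hxF, le_csSup (hFba _) hxF⟩
    have := (hp x hx.2).2 y hy
    rwa [hpx] at this

/-- A form of the rising sun lemma. -/
theorem exists_disjoint_intervals_of_lt {f : ℝ → ℝ} (hf : Continuous f) {a b : ℝ}
    (hab : a < b) (hfab : f a < f b) :
    ∃ S : Set (ℝ × ℝ), S.Countable ∧ S.PairwiseDisjoint (fun p => Set.Ioo p.1 p.2) ∧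
      (∀ p ∈ S, a ≤ p.1 ∧ p.1 < p.2 ∧ p.2 ≤ b ∧ f p.1 = f p.2) ∧
      ∀ x ∈ Set.Icc a b, (∀ p ∈ S, x ∉ Set.Icc p.1 p.2) → ∀ y ∈ Set.Icc x b, f x ≤ f y := by
  obtain ⟨d, ⟨⟨had, hdb⟩, hfd⟩, hd⟩ :=
    (isCompact_Icc.inter_right (isClosed_le hf continuous_const :
      IsClosed {x | f x ≤ f a})).exists_isGreatest ⟨a, ⟨le_rfl, hab.le⟩, le_refl (f a)⟩
  have hdb' : d < b := hdb.lt_of_ne (by rintro rfl; exact absurd hfab (not_lt.2 hfd))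
  have hgt : ∀ x ∈ Set.Ioc d b, f a ≤ f x := by
    intro x hx
    by_contra! h
    exact absurd (hd ⟨⟨had.trans hx.1.le, hx.2⟩, h.le⟩) (not_le.2 hx.1)
  have hda : f d = f a := by
    refine le_antisymm hfd ?_
    have hcl : IsClosed {y | f a ≤ f y} := isClosed_le continuous_const hf
    have : d ∈ closure {y | f a ≤ f y} := by
      refine closure_mono (s := Set.Ioc d b) hgt ?_
      rw [closure_Ioc hdb'.ne]
      exact ⟨le_rfl, hdb⟩
    rwa [hcl.closure_eq] at this
  obtain ⟨S, hSc, hSd, hS, hSx⟩ := exists_disjoint_intervals_of_le hf (a := d) (b := b) (by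
    intro x hx
    rcases hx.1.eq_or_lt with rfl | h
    · exact le_rfl
    · exact hda.le.trans (hgt x ⟨h, hx.2⟩))
  rcases had.eq_or_lt with rfl | had'
  · exact ⟨S, hSc, hSd, hS, hSx⟩
  refine ⟨insert (a, d) S, hSc.insert _, ?_, ?_, ?_⟩
  · refine hSd.insert fun p hp _ => Set.disjoint_left.2 fun x hx hx' => ?_
    have := (hS p hp).1
    linarith [hx.2, hx'.1]
  · rintro p (rfl | hp)
    · exact ⟨le_rfl, had', hdb, hda.symm⟩
    · exact ⟨had.trans (hS p hp).1, (hS p hp).2⟩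
  · intro x hx hxS
    have h1 := hxS (a, d) (Set.mem_insert _ _)
    have hdx : d ≤ x := by
      by_contra! h
      exact h1 ⟨hx.1, h.le⟩
    exact hSx x ⟨hdx, hx.2⟩ fun p hp => hxS p (Set.mem_insert_of_mem _ hp)

theorem exists_setIntegral_nonpos_of_lt_average {w φ : ℝ → ℝ} (hw : LocallyIntegrable w)
    (hφ : LocallyIntegrable φ) {a b l : ℝ} (hab : a < b) (hl : l * (b - a) < ∫ t in a..b, w t)
    (h : ∀ x y, x < y → ∫ t in x..y, w t = l * (y - x) → ∫ t in x..y, φ t ≤ 0) :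
    ∃ E ⊆ Set.Icc a b, MeasurableSet E ∧ ∫ t in E, φ t ≤ 0 ∧
      ∀ᵐ x, x ∈ Set.Icc a b → x ∉ E → l ≤ w x := by
  have hwi : ∀ x y, IntervalIntegrable w volume x y := fun x y =>
    (hw.integrableOn_isCompact isCompact_uIcc).intervalIntegrable
  have hcont : Continuous fun x => (∫ t in a..x, w t) - l * (x - a) := by
    have := intervalIntegral.continuous_primitive hwi a
    fun_prop
  obtain ⟨S, hSc, hSd, hS, hSx⟩ := exists_disjoint_intervals_of_lt hcont hab (by simpa using hl)
  have hsub : (⋃ p : S, Set.Ioo p.1.1 p.1.2) ⊆ Set.Icc a b := by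
    refine Set.iUnion_subset fun p x hx => ?_
    have := hS p.1 p.2
    exact ⟨this.1.trans hx.1.le, hx.2.le.trans this.2.2.1⟩
  have : Countable S := hSc.to_subtype
  refine ⟨⋃ p : S, Set.Ioo p.1.1 p.1.2, hsub, .iUnion fun _ => measurableSet_Ioo, ?_, ?_⟩
  · rw [integral_iUnion (fun _ => measurableSet_Ioo) (hSd.subtype _ _)
      ((hφ.integrableOn_isCompact isCompact_Icc).mono_set hsub)]
    refine tsum_nonpos fun p => ?_
    obtain ⟨h1, h2, h3, h4⟩ := hS p.1 p.2
    rw [← integral_Ioc_eq_integral_Ioo, ← intervalIntegral.integral_of_le h2.le]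
    refine h _ _ h2 ?_
    have := intervalIntegral.integral_add_adjacent_intervals (hwi a p.1.1) (hwi p.1.1 p.1.2)
    linarith
  · have hends : (⋃ p ∈ S, {p.1, p.2} : Set ℝ).Countable :=
      hSc.biUnion fun p _ => (Set.toFinite _).countable
    filter_upwards [LocallyIntegrable.ae_hasDerivAt_integral hw, hends.ae_notMem volume,
      (Set.countable_singleton b).ae_notMem volume] with x hx hxe hxb hxJ hxE
    have hxb' : x < b := hxJ.2.lt_of_ne hxb
    have hle : ∀ y ∈ Set.Icc x b, (∫ t in a..x, w t) - l * (x - a) ≤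
        (∫ t in a..y, w t) - l * (y - a) := by
      refine hSx x hxJ fun p hp hxp => ?_
      simp only [Set.mem_iUnion, Set.mem_insert_iff, Set.mem_singleton_iff, not_exists,
        not_or, Set.mem_Ioo, Subtype.exists] at hxe hxE
      have h1 := hxe p hp
      exact hxE p hp ⟨hxp.1.lt_of_ne (Ne.symm h1.1), hxp.2.lt_of_ne h1.2⟩
    have hd := (hx a).hasDerivWithinAt (s := Set.Ioi x)
    rw [hasDerivWithinAt_iff_tendsto_slope' (by simp)] at hd
    refine ge_of_tendsto hd ?_
    filter_upwards [Ioo_mem_nhdsGT hxb'] with y hy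
    rw [slope_def_field, le_div_iff₀ (by linarith [hy.1])]
    linarith [hle y ⟨hy.1.le, hy.2.le⟩]

/-- Up to scaling, the integrand whose average over an interval is controlled by the `RH₁`
condition. -/
noncomputable def entropyGap (c u : ℝ) : ℝ := u * log u + c * (1 - u)

/-- The primitive of `u ↦ -entropyGap c u / u` vanishing at `1`. -/
noncomputable def entropyGapPrimitive (c v : ℝ) : ℝ :=
  -(1 + c) * (1 - v) - v * log v - c * log v

theorem continuous_entropyGap (c : ℝ) : Continuous (entropyGap c) := by
  have := Real.continuous_mul_log
  unfold entropyGap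
  fun_prop

theorem measurable_entropyGapPrimitive (c : ℝ) : Measurable (entropyGapPrimitive c) := by
  unfold entropyGapPrimitive
  fun_prop

theorem sub_one_le_mul_log {u : ℝ} (hu : 0 < u) : u - 1 ≤ u * log u := by
  have h := mul_le_mul_of_nonneg_left (one_sub_inv_le_log_of_pos hu) hu.le
  rwa [mul_sub, mul_inv_cancel₀ hu.ne', mul_one] at h

theorem entropyGap_nonneg {c u : ℝ} (hc : c ≤ 1) (hu : 1 ≤ u) : 0 ≤ entropyGap c u := by
  have := sub_one_le_mul_log (zero_lt_one.trans_le hu)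
  unfold entropyGap
  nlinarith

theorem entropyGap_nonpos {c u : ℝ} (hc : 0 < c) (hcu : c ≤ u) (hu : u ≤ 1) :
    entropyGap c u ≤ 0 := by
  have h0 := hc.trans_le hcu
  have := mul_le_mul_of_nonneg_left (log_le_sub_one_of_pos h0) h0.le
  unfold entropyGap
  nlinarith

theorem abs_entropyGap_min_le {c v : ℝ} (hc0 : 0 ≤ c) (hc : c ≤ 1) (hv : 0 < v) :
    |entropyGap c (min v 1)| ≤ 2 := by
  have h0 : 0 < min v 1 := lt_min hv one_pos
  have h1 : min v 1 ≤ 1 := min_le_right _ _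
  have h2 := sub_one_le_mul_log h0
  have h3 := mul_nonpos_of_nonneg_of_nonpos h0.le (log_nonpos h0.le h1)
  unfold entropyGap
  rw [abs_le]
  constructor <;> nlinarith

theorem entropyGap_min_le {c v : ℝ} (hc : c ≤ 1) :
    entropyGap c (min v 1) ≤ entropyGap c v := by
  rcases le_total v 1 with h | h
  · rw [min_eq_left h]
  · rw [min_eq_right h]
    simpa [entropyGap] using entropyGap_nonneg hc h

theorem entropyGap_min_nonpos {c v : ℝ} (hc0 : 0 < c) (hc : c ≤ 1) (hv : c ≤ v) :
    entropyGap c (min v 1) ≤ 0 :=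
  entropyGap_nonpos hc0 (le_min hv hc) (min_le_right _ _)

theorem hasDerivAt_entropyGapPrimitive (c : ℝ) {v : ℝ} (hv : 0 < v) :
    HasDerivAt (entropyGapPrimitive c) (-(entropyGap c v / v)) v := by
  have h := (((hasDerivAt_id v).const_sub 1).const_mul (-(1 + c))).sub
    (Real.hasDerivAt_mul_log hv.ne') |>.sub ((Real.hasDerivAt_log hv.ne').const_mul c)
  refine h.congr_deriv ?_
  unfold entropyGap
  field_simp
  ring

theorem hasDerivAt_entropyGapPrimitive_min (c : ℝ) {v : ℝ} (hv : 0 < v) :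
    HasDerivAt (fun v => entropyGapPrimitive c (min v 1)) (-(entropyGap c (min v 1) / v)) v := by
  rcases lt_trichotomy v 1 with h | rfl | h
  · rw [min_eq_left h.le]
    refine (hasDerivAt_entropyGapPrimitive c hv).congr_of_eventuallyEq ?_
    filter_upwards [Iio_mem_nhds h] with x hx
    rw [min_eq_left (le_of_lt hx)]
  · have h1 := (hasDerivAt_entropyGapPrimitive c one_pos).hasDerivWithinAt (s := Set.Iic 1)
    have h2 : HasDerivWithinAt (fun _ : ℝ => entropyGapPrimitive c 1) 0 (Set.Ici 1) 1 :=
      (hasDerivAt_const _ _).hasDerivWithinAt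
    have h0 : -(entropyGap c (min 1 1) / 1) = 0 := by simp [entropyGap]
    have h0' : -(entropyGap c 1 / 1) = 0 := by simp [entropyGap]
    rw [h0]
    rw [h0'] at h1
    rw [← hasDerivWithinAt_univ, ← Set.Iic_union_Ici (a := (1 : ℝ))]
    refine HasDerivWithinAt.union (h1.congr ?_ (by simp)) (h2.congr ?_ (by simp))
    · intro x hx
      rw [min_eq_left hx]
    · intro x hx
      rw [min_eq_right hx]
  · rw [min_eq_right h.le]
    have : -(entropyGap c 1 / v) = 0 := by simp [entropyGap]
    rw [this]
    refine (hasDerivAt_const v (entropyGapPrimitive c 1)).congr_of_eventuallyEq ?_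
    filter_upwards [Ioi_mem_nhds h] with x hx
    rw [min_eq_right (le_of_lt hx)]

theorem abs_entropyGapPrimitive_le {c v : ℝ} (hc0 : 0 ≤ c) (hc : c ≤ 1) (hv : 0 < v)
    (hv1 : v ≤ 1) : |entropyGapPrimitive c v| ≤ 4 * -log v := by
  have h1 := log_le_sub_one_of_pos hv
  have h2 := sub_one_le_mul_log hv
  have h3 : 0 ≤ -log v := by linarith [log_nonpos hv.le hv1]
  have h4 : v * -log v ≤ 1 * -log v := mul_le_mul_of_nonneg_right hv1 h3
  have h5 : c * -log v ≤ 1 * -log v := mul_le_mul_of_nonneg_right hc h3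
  have h6 : 0 ≤ c * -log v := mul_nonneg hc0 h3
  have h7 : c * (1 - v) ≤ 1 * (1 - v) := mul_le_mul_of_nonneg_right hc (by linarith)
  have h8 : 0 ≤ c * (1 - v) := mul_nonneg hc0 (by linarith)
  have h9 : 0 ≤ v * -log v := mul_nonneg hv.le h3
  unfold entropyGapPrimitive
  rw [abs_le]
  constructor <;> linarith

theorem abs_entropyGapPrimitive_min_le {c x m M : ℝ} (hc0 : 0 ≤ c) (hc : c ≤ 1) (hx : 0 < x)
    (hm : 0 < m) (hmM : m ≤ M) :
    |entropyGapPrimitive c (min (x / m) 1)| ≤ 4 * (|log x| + |log M|) := by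
  refine (abs_entropyGapPrimitive_le hc0 hc (lt_min (div_pos hx hm) one_pos)
    (min_le_right _ _)).trans ?_
  have h1 : -log (min (x / m) 1) ≤ |log x| + |log M| := by
    rcases le_total (x / m) 1 with h | h
    · rw [min_eq_left h, log_div hx.ne' hm.ne']
      have := log_le_log hm hmM
      linarith [neg_abs_le (log x), le_abs_self (log M)]
    · rw [min_eq_right h, log_one, neg_zero]
      positivity
  linarith

theorem mul_neg_log_le {c : ℝ} (hc : c ≤ 1) (v : ℝ) :
    c * -log v ≤ entropyGapPrimitive c (min v 1) + (1 - v) + entropyGap c v := by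
  rcases le_total v 1 with h | h
  · rw [min_eq_left h]
    unfold entropyGapPrimitive entropyGap
    linarith
  · rw [min_eq_right h]
    have hmono : MonotoneOn (fun v => -entropyGapPrimitive c v) (Set.Ici 1) := by
      refine monotoneOn_of_hasDerivWithinAt_nonneg (convex_Ici 1)
        (f' := fun v => entropyGap c v / v) ?_ ?_ ?_
      · intro x hx
        exact (hasDerivAt_entropyGapPrimitive c
          (zero_lt_one.trans_le hx)).neg.continuousAt.continuousWithinAt
      · intro x hx
        rw [interior_Ici] at hx
        have := (hasDerivAt_entropyGapPrimitive c (zero_lt_one.trans hx)).neg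
        rw [neg_neg] at this
        exact this.hasDerivWithinAt
      · intro x hx
        rw [interior_Ici] at hx
        exact div_nonneg (entropyGap_nonneg hc (le_of_lt hx)) (zero_lt_one.trans hx).le
    have := hmono Set.self_mem_Ici h h
    simp only [entropyGapPrimitive, entropyGap, log_one] at this ⊢
    linarith

theorem integral_entropyGapPrimitive_nonpos {ν : Measure ℝ} [IsFiniteMeasure ν] {w : ℝ → ℝ}
    (hw : AEMeasurable w ν) (hpos : ∀ᵐ t ∂ν, 0 < w t)
    (hlog : Integrable (fun t => log (w t)) ν) {c M : ℝ} (hc0 : 0 ≤ c) (hc : c ≤ 1)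
    (hM : 0 < M) (hG : ∀ m ∈ Set.Ioo 0 M, ∫ t, entropyGap c (min (w t / m) 1) ∂ν ≤ 0) :
    Integrable (fun t => entropyGapPrimitive c (min (w t / M) 1)) ν ∧
      ∫ t, entropyGapPrimitive c (min (w t / M) 1) ∂ν ≤ 0 := by
  have hmeas : ∀ m, AEStronglyMeasurable (fun t => entropyGapPrimitive c (min (w t / m) 1)) ν :=
    fun m => ((measurable_entropyGapPrimitive c).comp_aemeasurable
      ((hw.div_const m).min aemeasurable_const)).aestronglyMeasurable
  have hbound : ∀ m M, 0 < m → m ≤ M →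
      ∀ᵐ t ∂ν, ‖entropyGapPrimitive c (min (w t / m) 1)‖ ≤ 4 * (|log (w t)| + |log M|) := by
    intro m M hm hmM
    filter_upwards [hpos] with t ht using abs_entropyGapPrimitive_min_le hc0 hc ht hm hmM
  have hbi : ∀ M, Integrable (fun t => 4 * (|log (w t)| + |log M|)) ν := fun M =>
    (hlog.abs.add (integrable_const _)).const_mul 4
  have hint : ∀ m, 0 < m → Integrable (fun t => entropyGapPrimitive c (min (w t / m) 1)) ν :=
    fun m hm => (hbi m).mono' (hmeas m) (hbound m m hm le_rfl)
  refine ⟨hint M hM, ?_⟩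
  have hderiv : ∀ m, 0 < m →
      HasDerivAt (fun m => ∫ t, entropyGapPrimitive c (min (w t / m) 1) ∂ν)
        (∫ t, entropyGap c (min (w t / m) 1) / m ∂ν) m := by
    intro m hm
    refine (hasDerivAt_integral_of_dominated_loc_of_deriv_le (s := Set.Ioi (m / 2))
      (F' := fun m t => entropyGap c (min (w t / m) 1) / m)
      (bound := fun _ => 2 / (m / 2)) (Ioi_mem_nhds (by linarith)) (.of_forall hmeas)
      (hint m hm) ?_ ?_ (integrable_const _) ?_).2
    · exact (((continuous_entropyGap c).measurable.comp_aemeasurable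
        ((hw.div_const m).min aemeasurable_const)).div_const m).aestronglyMeasurable
    · filter_upwards [hpos] with t ht x hx
      have hx0 : 0 < x := (half_pos hm).trans hx
      rw [norm_div, Real.norm_eq_abs, Real.norm_of_nonneg hx0.le]
      exact div_le_div₀ zero_le_two (abs_entropyGap_min_le hc0 hc (div_pos ht hx0))
        (half_pos hm) (le_of_lt hx)
    · filter_upwards [hpos] with t ht x hx
      have hx0 : 0 < x := (half_pos hm).trans hx
      have h1 : HasDerivAt (fun x => w t / x) (w t * -(x ^ 2)⁻¹) x := by
        simpa [div_eq_mul_inv] using (hasDerivAt_inv hx0.ne').const_mul (w t)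
      refine ((hasDerivAt_entropyGapPrimitive_min c (div_pos ht hx0)).comp x h1).congr_deriv ?_
      field_simp
  have hanti : AntitoneOn (fun m => ∫ t, entropyGapPrimitive c (min (w t / m) 1) ∂ν)
      (Set.Ioc 0 M) := by
    refine antitoneOn_of_hasDerivWithinAt_nonpos (convex_Ioc 0 M)
      (f' := fun m => ∫ t, entropyGap c (min (w t / m) 1) / m ∂ν) ?_ ?_ ?_
    · exact fun m hm => (hderiv m hm.1).continuousAt.continuousWithinAt
    · intro m hm
      exact (hderiv m (interior_subset hm).1).hasDerivWithinAt
    · intro m hm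
      rw [interior_Ioc] at hm
      rw [integral_div]
      exact div_nonpos_of_nonpos_of_nonneg (hG m hm) hm.1.le
  have hlim : Filter.Tendsto (fun m => ∫ t, entropyGapPrimitive c (min (w t / m) 1) ∂ν)
      (nhdsWithin 0 (Set.Ioi 0)) (nhds (∫ _, 0 ∂ν)) := by
    refine tendsto_integral_filter_of_dominated_convergence _ (.of_forall hmeas) ?_ (hbi M) ?_
    · filter_upwards [Ioc_mem_nhdsGT hM] with m hm using hbound m M hm.1 hm.2
    · filter_upwards [hpos] with t ht
      refine tendsto_const_nhds.congr' ?_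
      filter_upwards [Ioc_mem_nhdsGT ht] with m hm
      rw [min_eq_right ((one_le_div hm.1).2 hm.2)]
      simp [entropyGapPrimitive]
  rw [integral_zero] at hlim
  refine ge_of_tendsto hlim ?_
  filter_upwards [Ioc_mem_nhdsGT hM] with m hm using hanti hm ⟨hM, le_rfl⟩ hm.2

/-- **Theorem (bound on `[w]_{A_∞}` in terms of `[w]_{RH₁}`).**
Let `Q > 0` and let `γ₋ ∈ (0,1)` be the smaller root of `t − log t = Q + 1`.
If `w` is a weight with `w·log w` and `log w` locally integrable and `[w]_{RH₁} ≤ Q`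
(expressed interval-wise), then for every bounded interval `J` of positive length,
`⟨w⟩_J · exp(−⟨log w⟩_J) ≤ γ₋ · exp((1−γ₋)/γ₋)`; consequently
`[w]_{A_∞} ≤ γ₋ · exp((1−γ₋)/γ₋)`. -/
theorem ainfty_le_of_rh1
    (Q : ℝ) (hQ : 0 < Q) (γm : ℝ) (hγm : γm ∈ Set.Ioo (0:ℝ) 1)
    (hroot : γm - Real.log γm = Q + 1)
    (w : ℝ → ℝ) (hw : LocallyIntegrable w)
    (hpos : ∀ᵐ t ∂volume, 0 < w t)
    (hwlog : LocallyIntegrable (fun t => w t * Real.log (w t)))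
    (hlog : LocallyIntegrable (fun t => Real.log (w t)))
    (hRH : ∀ a b : ℝ, a < b →
      intAvg (fun t => w t * Real.log (w t)) a b ≤
        intAvg w a b * Real.log (intAvg w a b) + Q * intAvg w a b) :
    ∀ a b : ℝ, a < b →
      intAvg w a b * Real.exp (-(intAvg (fun t => Real.log (w t)) a b)) ≤
        γm * Real.exp ((1 - γm) / γm) := by
  intro a b hab
  obtain ⟨hγ0, hγ1⟩ := hγm
  have hba : 0 < b - a := sub_pos.2 hab
  have hii : ∀ {f : ℝ → ℝ}, LocallyIntegrable f → ∀ x y, IntervalIntegrable f volume x y :=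
    fun hf x y => (hf.integrableOn_isCompact isCompact_uIcc).intervalIntegrable
  let ψ : ℝ → ℝ → ℝ := fun m t =>
    m⁻¹ * (w t * log (w t)) - (log m + γm) / m * w t + γm
  have hψ : ∀ m, LocallyIntegrable (ψ m) := fun m =>
    ((hwlog.smul m⁻¹).sub (hw.smul ((log m + γm) / m))).add (locallyIntegrable_const γm)
  have hψeq : ∀ m, 0 < m → ∀ t, 0 < w t → ψ m t = entropyGap γm (w t / m) := by
    intro m hm t ht
    simp only [ψ, entropyGap]
    rw [log_div ht.ne' hm.ne']
    field_simp
    ring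
  have hψint : ∀ m, 0 < m → ∀ x y, x < y → ∫ t in x..y, w t = γm * m * (y - x) →
      ∫ t in x..y, ψ m t ≤ 0 := by
    intro m hm x y hxy hint
    have hyx : 0 < y - x := sub_pos.2 hxy
    have h1 : ∫ t in x..y, ψ m t = m⁻¹ * (∫ t in x..y, w t * log (w t)) -
        (log m + γm) / m * (∫ t in x..y, w t) + (y - x) * γm := by
      simp only [ψ]
      rw [intervalIntegral.integral_add, intervalIntegral.integral_sub,
        intervalIntegral.integral_const_mul, intervalIntegral.integral_const_mul,
        intervalIntegral.integral_const, smul_eq_mul]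
      · exact (hii hwlog x y).const_mul _
      · exact (hii hw x y).const_mul _
      · exact ((hii hwlog x y).const_mul _).sub ((hii hw x y).const_mul _)
      · exact intervalIntegrable_const
    have h2 := hRH x y hxy
    have h3 : intAvg w x y = γm * m := by
      rw [intAvg, hint]
      field_simp
    rw [h3, log_mul hγ0.ne' hm.ne', intAvg, inv_mul_le_iff₀ hyx] at h2
    have h4 := mul_le_mul_of_nonneg_left h2 (inv_nonneg.2 hm.le)
    have hQ' : Q = γm - log γm - 1 := by linarith
    have h5 : m⁻¹ * ((y - x) * (γm * m * (log γm + log m) + Q * (γm * m))) -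
        (log m + γm) / m * (γm * m * (y - x)) + (y - x) * γm = 0 := by
      rw [hQ']
      field_simp
      ring
    rw [h1, hint]
    linarith
  set M : ℝ := intAvg w a b / γm with hM
  have hwint : ∫ t in a..b, w t = γm * M * (b - a) := by
    rw [hM, intAvg]
    field_simp
  have hposJ : ∀ᵐ t ∂volume.restrict (Set.Ioc a b), 0 < w t := ae_restrict_of_ae hpos
  have hwJ : Integrable w (volume.restrict (Set.Ioc a b)) := (hii hw a b).1
  have hlogJ : Integrable (fun t => log (w t)) (volume.restrict (Set.Ioc a b)) :=
    (hii hlog a b).1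
  have hM0 : 0 < M := by
    have h0 : 0 < ∫ t in a..b, w t := by
      rw [intervalIntegral.integral_of_le hab.le,
        integral_pos_iff_support_of_nonneg_ae (hposJ.mono fun _ h => h.le) hwJ,
        measure_congr (t := Set.univ) (Filter.eventuallyEq_set.2 (hposJ.mono fun t h => by
          simp [h.ne']))]
      simpa using hab
    exact div_pos (mul_pos (inv_pos.2 hba) h0) hγ0
  have hG : ∀ m ∈ Set.Ioo 0 M,
      ∫ t in Set.Ioc a b, entropyGap γm (min (w t / m) 1) ≤ 0 := by
    intro m hm
    obtain ⟨E, hEs, hEm, hEint, hE⟩ :=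
      exists_setIntegral_nonpos_of_lt_average (l := γm * m) hw (hψ m) hab
        (by rw [hwint]; have := hm.2; gcongr) (hψint m hm.1)
    have hEi : IntegrableOn (ψ m) E :=
      ((hψ m).integrableOn_isCompact isCompact_Icc).mono_set hEs
    rw [← integral_Icc_eq_integral_Ioc]
    calc ∫ t in Set.Icc a b, entropyGap γm (min (w t / m) 1)
        ≤ ∫ t in Set.Icc a b, E.indicator (ψ m) t := by
          have hmeas : AEStronglyMeasurable (fun t => entropyGap γm (min (w t / m) 1))
              (volume.restrict (Set.Icc a b)) :=
            ((continuous_entropyGap γm).measurable.comp_aemeasurable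
              ((hw.aestronglyMeasurable.aemeasurable.restrict.div_const m).min
                aemeasurable_const)).aestronglyMeasurable
          refine integral_mono_ae ?_ ?_ ?_
          · refine Integrable.of_bound hmeas 2 ?_
            filter_upwards [ae_restrict_of_ae hpos] with t ht using
              abs_entropyGap_min_le hγ0.le hγ1.le (div_pos ht hm.1)
          · exact (hEi.integrable_indicator hEm).integrableOn
          · filter_upwards [ae_restrict_of_ae hpos, ae_restrict_of_ae hE,
              ae_restrict_mem measurableSet_Icc] with t ht htE htJ
            by_cases h : t ∈ E
            · rw [Set.indicator_of_mem h, hψeq m hm.1 t ht]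
              exact entropyGap_min_le hγ1.le
            · rw [Set.indicator_of_notMem h]
              exact entropyGap_min_nonpos hγ0 hγ1.le ((le_div_iff₀ hm.1).2 (htE htJ h))
      _ = ∫ t in E, ψ m t := by
          rw [setIntegral_indicator hEm, Set.inter_eq_self_of_subset_right hEs]
      _ ≤ 0 := hEint
  obtain ⟨hPi, hP⟩ := integral_entropyGapPrimitive_nonpos hwJ.aestronglyMeasurable.aemeasurable
    hposJ hlogJ hγ0.le hγ1.le hM0 hG
  have hψM := hψint M hM0 a b hab hwint
  have hψi : Integrable (ψ M) (volume.restrict (Set.Ioc a b)) := (hii (hψ M) a b).1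
  have h1i : Integrable (fun t => 1 - w t / M) (volume.restrict (Set.Ioc a b)) :=
    (integrable_const _).sub (hwJ.div_const M)
  have h2i : Integrable (fun t => entropyGapPrimitive γm (min (w t / M) 1) + (1 - w t / M))
      (volume.restrict (Set.Ioc a b)) := hPi.add h1i
  have hmain : ∫ t in Set.Ioc a b, γm * (log M - log (w t)) ≤
      ∫ t in Set.Ioc a b, (entropyGapPrimitive γm (min (w t / M) 1) + (1 - w t / M) + ψ M t) := by
    refine integral_mono_ae (((integrable_const _).sub hlogJ).const_mul _)
      (h2i.add hψi) ?_
    filter_upwards [hposJ] with t ht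
    have := mul_neg_log_le hγ1.le (w t / M)
    rw [← hψeq M hM0 t ht, log_div ht.ne' hM0.ne'] at this
    simpa using this
  have hconst : ∀ k : ℝ, ∫ _ in Set.Ioc a b, k = (b - a) * k := fun k => by
    simp [hab.le]
  rw [integral_add h2i hψi, integral_add hPi h1i,
    integral_sub (integrable_const _) (hwJ.div_const M), integral_div, integral_const_mul,
    integral_sub (integrable_const _) hlogJ, hconst, hconst,
    ← intervalIntegral.integral_of_le hab.le (f := ψ M),
    ← intervalIntegral.integral_of_le hab.le (f := w),
    ← intervalIntegral.integral_of_le hab.le (f := fun t => log (w t)), hwint,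
    mul_right_comm, mul_div_cancel_right₀ _ hM0.ne'] at hmain
  have hA : intAvg w a b = γm * M := by rw [hM]; field_simp
  have hlogavg : ∫ t in a..b, log (w t) = (b - a) * intAvg (fun t => log (w t)) a b := by
    rw [intAvg]
    field_simp
  rw [hlogavg] at hmain
  have hfin : log M - intAvg (fun t => log (w t)) a b ≤ (1 - γm) / γm := by
    rw [le_div_iff₀ hγ0]
    refine le_of_mul_le_mul_left ?_ hba
    linarith
  rw [hA, mul_assoc]
  refine mul_le_mul_of_nonneg_left ?_ hγ0.le
  calc M * exp (-intAvg (fun t => log (w t)) a b)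
      = exp (log M - intAvg (fun t => log (w t)) a b) := by
        rw [sub_eq_add_neg, exp_add, exp_log hM0]
    _ ≤ exp ((1 - γm) / γm) := exp_le_exp.2 hfin
end

section
/- Let Q > 0, let γ_+ > 1 be the larger root of γ − log γ = Q + 1, and let x > 0. Define w on (0,1] by w(t) = (x/γ_+)·t^{(1−γ_+)/γ_+}. Then: (i) for every subinterval J ⊂ [0,1] of positive length, ⟨w·log w⟩_J ≤ ⟨w⟩_J·log(⟨w⟩_J) + Q·⟨w⟩_J, i.e. the RH_1 constant of w on [0,1] is at most Q; (ii) for every ε with 0 < ε < 1/(γ_+ − 1), ∫_0^1 w(t)^{1+ε} dt = x^{1+ε}·γ_+^{−ε}/(1 − ε(γ_+ − 1)); (iii) ∫_0^1 w(t)^{1 + 1/(γ_+ − 1)} dt = ∞. In particular, the exponent ε_− = 1/(γ_+ − 1) in the sharp 1-Gehring lemma cannot be attained. -/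
open MeasureTheory Real

/-- The logarithmic inequality that bounds the entropy of a power weight over `(a, b)`. -/
lemma rpow_sub_mul_log_le {p a b : ℝ} (hp0 : 0 < p) (ha : 0 ≤ a) (hab : a < b) :
    (b ^ p - a ^ p) * (Real.log (b - a) - Real.log (b ^ p - a ^ p)) ≤
      (1 - p) * (b ^ p * Real.log b - a ^ p * Real.log a) := by
  have hb : 0 < b := ha.trans_lt hab
  have hD : 0 < b ^ p - a ^ p := sub_pos.2 (Real.rpow_lt_rpow ha hab hp0)
  have hL : 0 < b - a := sub_pos.2 hab
  set D := b ^ p - a ^ p with hDdef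
  have hc : 0 < b ^ (p - 1) := Real.rpow_pos_of_pos hb _
  have h1 := Real.log_le_sub_one_of_pos (div_pos (mul_pos hL hc) hD)
  rw [Real.log_div (mul_pos hL hc).ne' hD.ne', Real.log_mul hL.ne' hc.ne',
    Real.log_rpow hb] at h1
  have h2 : D * (Real.log (b - a) - Real.log D) ≤
      D * ((1 - p) * Real.log b) + ((b - a) * b ^ (p - 1) - D) := by
    have h := mul_le_mul_of_nonneg_left h1 hD.le
    have hcancel : D * ((b - a) * b ^ (p - 1) / D - 1) = (b - a) * b ^ (p - 1) - D := by
      field_simp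
    rw [hcancel] at h
    linarith
  have h3 : (b - a) * b ^ (p - 1) - D ≤ (1 - p) * (a ^ p * (Real.log b - Real.log a)) := by
    have hbp : b * b ^ (p - 1) = b ^ p := by
      rw [Real.rpow_sub_one hb.ne']; field_simp
    rcases ha.eq_or_lt with rfl | ha
    · have h0 : (0 : ℝ) ^ p = 0 := Real.zero_rpow hp0.ne'
      rw [hDdef, h0, sub_zero, hbp]
      simp
    · have hap : 0 < a ^ p := Real.rpow_pos_of_pos ha _
      have h4 := Real.log_le_sub_one_of_pos (div_pos (mul_pos ha hc) hap)
      rw [Real.log_div (mul_pos ha hc).ne' hap.ne', Real.log_mul ha.ne' hc.ne',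
        Real.log_rpow hb, Real.log_rpow ha] at h4
      have h := mul_le_mul_of_nonneg_left h4 hap.le
      have hcancel : a ^ p * (a * b ^ (p - 1) / a ^ p - 1) = a * b ^ (p - 1) - a ^ p := by
        field_simp
      rw [hcancel] at h
      rw [hDdef, sub_mul, hbp]
      linarith
  rw [hDdef] at h2 h3 ⊢
  linarith

/-- The function `t ↦ t ^ (p - 1) * log t` is integrable near the origin for `p > 0`, with the
integral given by its antiderivative. -/
lemma intervalIntegrable_and_integral_rpow_mul_log {p a b : ℝ} (hp : 0 < p) (ha : 0 ≤ a)
    (hab : a ≤ b) (hb : b ≤ 1) :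
    IntervalIntegrable (fun t => t ^ (p - 1) * Real.log t) volume a b ∧
      ∫ t in a..b, t ^ (p - 1) * Real.log t =
        (b ^ p * Real.log b - a ^ p * Real.log a) / p - (b ^ p - a ^ p) / p ^ 2 := by
  set G : ℝ → ℝ := fun t => (t ^ p * Real.log (t ^ p) - t ^ p) / p ^ 2 with hG
  have hGc : Continuous G := by
    have hpow : Continuous fun t : ℝ => t ^ p := Real.continuous_rpow_const hp.le
    exact ((Real.continuous_mul_log.comp hpow).sub hpow).div_const _
  have hderiv : ∀ t ∈ Set.Ioo a b, HasDerivAt G (t ^ (p - 1) * Real.log t) t := by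
    intro t ht
    have ht0 : 0 < t := ha.trans_lt ht.1
    have hpow : HasDerivAt (fun t : ℝ => t ^ p) (p * t ^ (p - 1)) t :=
      Real.hasDerivAt_rpow_const (Or.inl ht0.ne')
    have htp : t ^ p ≠ 0 := (Real.rpow_pos_of_pos ht0 p).ne'
    have h := ((hpow.mul (hpow.log htp)).sub hpow).div_const (p ^ 2)
    refine h.congr_deriv ?_
    rw [Real.log_rpow ht0]
    field_simp
    ring
  have hint : IntervalIntegrable (fun t => t ^ (p - 1) * Real.log t) volume a b := by
    rw [intervalIntegrable_iff_integrableOn_Ioc_of_le hab]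
    have h := intervalIntegral.integrableOn_deriv_of_nonneg (g := fun t => -G t)
      (g' := fun t => -(t ^ (p - 1) * Real.log t)) (a := a) (b := b)
      hGc.neg.continuousOn (fun t ht => (hderiv t ht).neg) (fun t ht => by
        have ht0 : 0 < t := ha.trans_lt ht.1
        have := Real.log_nonpos ht0.le (ht.2.le.trans hb)
        have := Real.rpow_pos_of_pos ht0 (p - 1)
        nlinarith)
    simpa using h.neg
  refine ⟨hint, ?_⟩
  rw [intervalIntegral.integral_eq_sub_of_hasDerivAt_of_le hab hGc.continuousOn hderiv hint]
  have hGval : ∀ t, 0 ≤ t → G t = t ^ p * Real.log t / p - t ^ p / p ^ 2 := by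
    intro t ht
    rcases ht.eq_or_lt with rfl | ht
    · simp [hG, Real.zero_rpow hp.ne']
    · simp only [hG, Real.log_rpow ht]
      field_simp
  rw [hGval b (ha.trans hab), hGval a ha]
  ring

/-- **Extremal weight for the sharp 1-Gehring lemma.**
Let `Q > 0`, let `γ₊ > 1` be the larger root of `γ − log γ = Q + 1`, let `x > 0` and let
`w(t) = (x/γ₊)·t^{(1−γ₊)/γ₊}` on `(0,1]`. Then:
(i) the `RH₁` constant of `w` on `[0,1]` is at most `Q`;
(ii) for every `0 < ε < 1/(γ₊−1)`,
`∫₀¹ w^{1+ε} = x^{1+ε}·γ₊^{−ε}/(1 − ε(γ₊−1))`;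
(iii) `∫₀¹ w^{1 + 1/(γ₊−1)} = ∞`.
In particular the exponent `ε₋ = 1/(γ₊ − 1)` in the sharp 1-Gehring lemma is not
attained. -/
theorem extremal_weight_one_gehring
    (Q : ℝ) (hQ : 0 < Q) (γp : ℝ) (hγp : 1 < γp)
    (hroot : γp - Real.log γp = Q + 1)
    (x : ℝ) (hx : 0 < x)
    (w : ℝ → ℝ) (hwdef : ∀ t ∈ Set.Ioc (0:ℝ) 1, w t = (x/γp) * t ^ ((1-γp)/γp)) :
    (∀ a b : ℝ, 0 ≤ a → a < b → b ≤ 1 →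
      intAvg (fun t => w t * Real.log (w t)) a b ≤
        intAvg w a b * Real.log (intAvg w a b) + Q * intAvg w a b) ∧
    (∀ ε : ℝ, 0 < ε → ε < 1/(γp - 1) →
      ∫ t in (0:ℝ)..1, (w t) ^ (1+ε) = x ^ (1+ε) * γp ^ (-ε) / (1 - ε * (γp - 1))) ∧
    (∫⁻ t in Set.Ioc (0:ℝ) 1, ENNReal.ofReal ((w t) ^ (1 + 1/(γp - 1))) = ⊤) := by
  have hg : 0 < γp := one_pos.trans hγp
  have hg1 : 0 < γp - 1 := sub_pos.2 hγp
  have hxg : 0 < x / γp := div_pos hx hg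
  have hwpow : ∀ r : ℝ, ∀ t ∈ Set.Ioc (0:ℝ) 1,
      w t ^ r = (x / γp) ^ r * t ^ ((1 - γp) / γp * r) := by
    intro r t ht
    rw [hwdef t ht, Real.mul_rpow hxg.le (Real.rpow_nonneg ht.1.le _), ← Real.rpow_mul ht.1.le]
  refine ⟨?_, ?_, ?_⟩
  · intro a b ha hab hb
    obtain ⟨p, hp⟩ : ∃ p, p = 1 / γp := ⟨_, rfl⟩
    have hp0 : 0 < p := by rw [hp]; positivity
    have hgp : γp = 1 / p := by rw [hp, one_div_one_div]
    have hexp : (1 - γp) / γp = p - 1 := by rw [hp]; field_simp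
    have hsub : ∀ t ∈ Set.Ioc a b, t ∈ Set.Ioc (0:ℝ) 1 := fun t ht =>
      ⟨ha.trans_lt ht.1, ht.2.trans hb⟩
    have hIpow : ∫ t in a..b, t ^ (p - 1) = (b ^ p - a ^ p) / p := by
      rw [integral_rpow (Or.inl (by linarith)), sub_add_cancel]
    obtain ⟨hlogint, hIlog⟩ := intervalIntegrable_and_integral_rpow_mul_log hp0 ha hab.le hb
    have hIw : ∫ t in a..b, w t = x * (b ^ p - a ^ p) := by
      have hcongr : ∫ t in a..b, w t = ∫ t in a..b, x / γp * t ^ (p - 1) := by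
        rw [intervalIntegral.integral_of_le hab.le, intervalIntegral.integral_of_le hab.le]
        refine setIntegral_congr_fun measurableSet_Ioc fun t ht => ?_
        simp only [hwdef t (hsub t ht), hexp]
      rw [hcongr, intervalIntegral.integral_const_mul, hIpow, hgp]
      field_simp
    have hIwlog : ∫ t in a..b, w t * Real.log (w t) =
        x * p * (Real.log (x / γp) * ((b ^ p - a ^ p) / p) + (p - 1) *
          ((b ^ p * Real.log b - a ^ p * Real.log a) / p - (b ^ p - a ^ p) / p ^ 2)) := by
      have hcongr : ∫ t in a..b, w t * Real.log (w t) =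
          ∫ t in a..b, x * p * (Real.log (x / γp) * t ^ (p - 1) +
            (p - 1) * (t ^ (p - 1) * Real.log t)) := by
        rw [intervalIntegral.integral_of_le hab.le, intervalIntegral.integral_of_le hab.le]
        refine setIntegral_congr_fun measurableSet_Ioc fun t ht => ?_
        have ht0 := (hsub t ht).1
        simp only [hwdef t (hsub t ht), hexp]
        rw [Real.log_mul hxg.ne' (Real.rpow_pos_of_pos ht0 _).ne', Real.log_rpow ht0, hp]
        ring
      rw [hcongr, intervalIntegral.integral_const_mul, intervalIntegral.integral_add
        ((intervalIntegral.intervalIntegrable_rpow' (by linarith)).const_mul _)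
        (hlogint.const_mul _), intervalIntegral.integral_const_mul,
        intervalIntegral.integral_const_mul, hIpow, hIlog]
    have hD : 0 < b ^ p - a ^ p := sub_pos.2 (Real.rpow_lt_rpow ha hab hp0)
    have hL : 0 < b - a := sub_pos.2 hab
    have hkey := mul_le_mul_of_nonneg_left (rpow_sub_mul_log_le hp0 ha hab) hx.le
    have hlogavg : Real.log ((b - a)⁻¹ * (x * (b ^ p - a ^ p))) =
        Real.log x + Real.log (b ^ p - a ^ p) - Real.log (b - a) := by
      rw [Real.log_mul (inv_pos.2 hL).ne' (mul_pos hx hD).ne', Real.log_inv,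
        Real.log_mul hx.ne' hD.ne']
      ring
    have hQeq : Q = 1 / p - Real.log γp - 1 := by rw [← hgp]; linarith
    simp only [intAvg]
    rw [hIw, hIwlog, hlogavg, Real.log_div hx.ne' hg.ne', hQeq, mul_assoc (b - a)⁻¹,
      mul_left_comm (1 / p - Real.log γp - 1), ← mul_add]
    refine mul_le_mul_of_nonneg_left ?_ (inv_pos.2 hL).le
    rw [← sub_nonneg] at hkey ⊢
    refine hkey.trans_eq ?_
    field_simp
    ring
  · intro ε _ hε1
    have hden : 0 < 1 - ε * (γp - 1) := by
      rw [lt_div_iff₀ hg1] at hε1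
      linarith
    have hexp : (1 - γp) / γp * (1 + ε) + 1 = (1 - ε * (γp - 1)) / γp := by
      field_simp
      ring
    have hexp_pos : 0 < (1 - γp) / γp * (1 + ε) + 1 := by rw [hexp]; positivity
    have hcongr : ∫ t in (0:ℝ)..1, w t ^ (1 + ε) =
        ∫ t in (0:ℝ)..1, (x / γp) ^ (1 + ε) * t ^ ((1 - γp) / γp * (1 + ε)) := by
      rw [intervalIntegral.integral_of_le zero_le_one, intervalIntegral.integral_of_le zero_le_one]
      exact setIntegral_congr_fun measurableSet_Ioc fun t ht => hwpow _ t ht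
    rw [hcongr, intervalIntegral.integral_const_mul, integral_rpow (Or.inl (by linarith)),
      Real.zero_rpow hexp_pos.ne', Real.one_rpow, hexp, Real.div_rpow hx.le hg.le,
      Real.rpow_neg hg.le, Real.rpow_add hg, Real.rpow_one]
    have := (Real.rpow_pos_of_pos hg ε).ne'
    field_simp
    ring
  · by_contra hfin
    set r := 1 + 1 / (γp - 1) with hr
    have hexp : (1 - γp) / γp * r = -1 := by
      rw [hr]
      field_simp
      ring
    have hc : 0 < (x / γp) ^ r := Real.rpow_pos_of_pos hxg r
    have hcongr : ∫⁻ t in Set.Ioc (0:ℝ) 1, ENNReal.ofReal (w t ^ r) =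
        ∫⁻ t in Set.Ioc (0:ℝ) 1, ENNReal.ofReal ((x / γp) ^ r * t⁻¹) := by
      refine setLIntegral_congr_fun measurableSet_Ioc fun t ht => ?_
      simp only [hwpow r t ht, hexp, Real.rpow_neg_one]
    rw [hcongr] at hfin
    have hint : IntegrableOn (fun t : ℝ => (x / γp) ^ r * t⁻¹) (Set.Ioc 0 1) := by
      refine (lintegral_ofReal_ne_top_iff_integrable
        (by fun_prop : Measurable fun t : ℝ => (x / γp) ^ r * t⁻¹).aestronglyMeasurable ?_).1 hfin
      refine (ae_restrict_iff' measurableSet_Ioc).2 (Filter.Eventually.of_forall fun t ht => ?_)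
      exact mul_nonneg hc.le (inv_nonneg.2 ht.1.le)
    have hinv : IntervalIntegrable (fun t : ℝ => t⁻¹) volume 0 1 := by
      rw [intervalIntegrable_iff_integrableOn_Ioc_of_le zero_le_one]
      refine (hint.const_mul ((x / γp) ^ r)⁻¹).congr (Filter.Eventually.of_forall fun t => ?_)
      simp only
      rw [inv_mul_cancel_left₀ hc.ne']
    rw [intervalIntegrable_inv_iff] at hinv
    simp at hinv
end
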